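/- arXiv:2203.00996 — 4 statements merged into one kernel-verified Lean document; each statement's English description precedes it below -/
import Mathlib

section
/- Let r ≥ 0, μ < -1, and let K be analytic on the half-plane {s ∈ ℂ : Re s > 0} with |K(s) e^{s r}| ≤ C |s|^μ for all Re s > 0 and some constant C > 0. Then for every σ > 0 the Bromwich integral k(t) := (1/2π) ∫_ℝ e^{(σ + i y) t} K(σ + i y) dy is absolutely convergent, and k(t) = 0 for all t ≤ r. -/
open MeasureTheory Set

lemma bromwich_norm_bound (r : ℝ) (μ : ℝ) (K : ℂ → ℂ) (C : ℝ)
    (hbound : ∀ s : ℂ, 0 < s.re → ‖K s * Complex.exp (s * r)‖ ≤ C * ‖s‖ ^ μ)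
    (t : ℝ) (s : ℂ) (hs : 0 < s.re) :
    ‖Complex.exp (s * t) * K s‖ ≤ Real.exp (s.re * (t - r)) * (C * ‖s‖ ^ μ) := by
  have h1 : Complex.exp (s * t) * K s
      = Complex.exp (s * ((t - r : ℝ) : ℂ)) * (K s * Complex.exp (s * r)) := by
    have : Complex.exp (s * t) = Complex.exp (s * ((t - r : ℝ) : ℂ)) * Complex.exp (s * r) := by
      rw [← Complex.exp_add]
      congr 1
      push_cast
      ring
    rw [this]
    ring
  rw [h1, norm_mul, Complex.norm_exp]
  have h2 : (s * ((t - r : ℝ) : ℂ)).re = s.re * (t - r) := Complex.re_mul_ofReal _ _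
  rw [h2]
  exact mul_le_mul_of_nonneg_left (hbound s hs) (Real.exp_pos _).le

lemma bromwich_integrable (r : ℝ) (μ : ℝ) (hμ : μ < -1) (K : ℂ → ℂ)
    (hK : DifferentiableOn ℂ K {s : ℂ | 0 < s.re})
    (C : ℝ) (hC : 0 < C)
    (hbound : ∀ s : ℂ, 0 < s.re → ‖K s * Complex.exp (s * r)‖ ≤ C * ‖s‖ ^ μ)
    (σ : ℝ) (hσ : 0 < σ) (t : ℝ) : Integrable (fun y : ℝ =>
          Complex.exp ((σ + y * Complex.I) * t) * K (σ + y * Complex.I)) := by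
  have hcont : Continuous (fun y : ℝ =>
      Complex.exp ((σ + y * Complex.I) * t) * K (σ + y * Complex.I)) := by
    refine Continuous.mul (by fun_prop) ?_
    refine hK.continuousOn.comp_continuous (by fun_prop) ?_
    intro y
    simpa using hσ
  have hint : Integrable (fun y : ℝ => (1 + ‖y‖) ^ (-(-μ))) :=
    integrable_one_add_norm (by simp; linarith)
  set c : ℝ := min σ 1 / 2 with hc
  have hc0 : 0 < c := by positivity
  have hcs : 2 * c ≤ σ := by rw [hc]; linarith [min_le_left σ 1]
  have hc1 : 2 * c ≤ 1 := by rw [hc]; linarith [min_le_right σ 1]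
  refine (hint.const_mul (Real.exp (σ * (t - r)) * C * c ^ μ)).mono'
    hcont.aestronglyMeasurable (Filter.Eventually.of_forall fun y => ?_)
  have hb := bromwich_norm_bound r μ K C hbound t (σ + y * Complex.I) (by simpa using hσ)
  have hre : ((σ : ℂ) + y * Complex.I).re = σ := by simp
  have him : ((σ : ℂ) + y * Complex.I).im = y := by simp
  have n1 := Complex.abs_re_le_norm ((σ : ℂ) + y * Complex.I)
  have n2 := Complex.abs_im_le_norm ((σ : ℂ) + y * Complex.I)
  rw [hre, abs_of_pos hσ] at n1
  rw [him] at n2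
  rw [hre] at hb
  refine hb.trans ?_
  have hle : c * (1 + |y|) ≤ ‖(σ : ℂ) + y * Complex.I‖ := by
    nlinarith [abs_nonneg y]
  have hp := Real.rpow_le_rpow_of_nonpos (by positivity) hle (by linarith : μ ≤ 0)
  rw [Real.mul_rpow hc0.le (by positivity)] at hp
  rw [neg_neg, Real.norm_eq_abs]
  calc _ ≤ Real.exp (σ * (t - r)) * (C * (c ^ μ * (1 + |y|) ^ μ)) := by gcongr
    _ = _ := by ring

lemma bromwich_box (r : ℝ) (μ : ℝ) (hμ : μ < -1) (K : ℂ → ℂ)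
    (hK : DifferentiableOn ℂ K {s : ℂ | 0 < s.re})
    (C : ℝ) (hC : 0 < C)
    (hbound : ∀ s : ℂ, 0 < s.re → ‖K s * Complex.exp (s * r)‖ ≤ C * ‖s‖ ^ μ)
    (σ : ℝ) (hσ : 0 < σ) (t : ℝ) (ht : t ≤ r) (R : ℝ) (hR : 0 < R) :
    ‖∫ y in (-R)..R, Complex.exp ((σ + y * Complex.I) * t) * K (σ + y * Complex.I)‖
      ≤ 4 * C * R ^ (μ + 1) := by
  set F : ℂ → ℂ := fun s => Complex.exp (s * t) * K s with hF
  have hFb : ∀ s : ℂ, 0 < s.re → R ≤ ‖s‖ → ‖F s‖ ≤ C * R ^ μ := by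
    intro s hs hRs
    refine (bromwich_norm_bound r μ K C hbound t s hs).trans ?_
    have h1 : Real.exp (s.re * (t - r)) ≤ 1 :=
      Real.exp_le_one_iff.2 (mul_nonpos_of_nonneg_of_nonpos hs.le (by linarith))
    have h2 := Real.rpow_le_rpow_of_nonpos hR hRs (by linarith : μ ≤ 0)
    calc _ ≤ 1 * (C * R ^ μ) := by gcongr
      _ = _ := one_mul _
  have hFd : DifferentiableOn ℂ F {s : ℂ | 0 < s.re} := by
    refine DifferentiableOn.mul (Differentiable.differentiableOn (by fun_prop)) hK
  have hcau := Complex.integral_boundary_rect_eq_zero_of_differentiableOn F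
    (⟨σ, -R⟩ : ℂ) (⟨σ + R, R⟩ : ℂ) (hFd.mono (by
      rintro z ⟨hz, -⟩
      simp only [mem_preimage, uIcc_of_le (by linarith : σ ≤ σ + R), mem_Icc] at hz
      exact lt_of_lt_of_le hσ hz.1))
  simp only at hcau
  have hbot : ‖∫ x in σ..(σ + R), F (x + (-R : ℝ) * Complex.I)‖ ≤ C * R ^ μ * |σ + R - σ| := by
    refine intervalIntegral.norm_integral_le_of_norm_le_const fun x hx => ?_
    rw [uIoc_of_le (by linarith)] at hx
    refine hFb _ (by simpa using hσ.trans hx.1) ?_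
    have := Complex.abs_im_le_norm ((x : ℂ) + (-R : ℝ) * Complex.I)
    simpa [abs_of_pos hR] using this
  have htop : ‖∫ x in σ..(σ + R), F (x + R * Complex.I)‖ ≤ C * R ^ μ * |σ + R - σ| := by
    refine intervalIntegral.norm_integral_le_of_norm_le_const fun x hx => ?_
    rw [uIoc_of_le (by linarith)] at hx
    refine hFb _ (by simpa using hσ.trans hx.1) ?_
    have := Complex.abs_im_le_norm ((x : ℂ) + R * Complex.I)
    simpa [abs_of_pos hR] using this
  have hright : ‖∫ y in (-R)..R, F ((σ + R : ℝ) + y * Complex.I)‖ ≤ C * R ^ μ * |R - -R| := by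
    refine intervalIntegral.norm_integral_le_of_norm_le_const fun y hy => ?_
    refine hFb _ (by simp; linarith) ?_
    have := Complex.re_le_norm (((σ + R : ℝ) : ℂ) + y * Complex.I)
    simp only [Complex.add_re, Complex.ofReal_re, Complex.re_ofReal_mul, Complex.I_re,
      mul_zero, add_zero] at this
    linarith
  rw [show |σ + R - σ| = R by rw [add_sub_cancel_left, abs_of_pos hR]] at hbot htop
  rw [show |R - -R| = 2 * R by rw [sub_neg_eq_add, abs_of_pos (by linarith)]; ring] at hright
  have hpow : R ^ (μ + 1) = R ^ μ * R := by rw [Real.rpow_add hR, Real.rpow_one]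
  rw [hpow]
  set A := ∫ x in σ..(σ + R), F (x + (-R : ℝ) * Complex.I)
  set B := ∫ x in σ..(σ + R), F (x + R * Complex.I)
  set D := ∫ y in (-R)..R, F ((σ + R : ℝ) + y * Complex.I)
  change ‖∫ y in (-R)..R, F (σ + y * Complex.I)‖ ≤ _
  set E := ∫ y in (-R)..R, F (σ + y * Complex.I)
  have hE : Complex.I • E = A - B + Complex.I • D := by linear_combination (-1 : ℂ) * hcau
  have hn : ‖E‖ = ‖A - B + Complex.I • D‖ := by rw [← hE, norm_smul, Complex.norm_I, one_mul]
  rw [hn]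
  have hD : ‖Complex.I • D‖ = ‖D‖ := by rw [norm_smul, Complex.norm_I, one_mul]
  have := norm_add_le (A - B) (Complex.I • D)
  have := norm_sub_le A B
  linarith

/-- If `K` is analytic on the right half-plane and
`|K(s) e^{sr}| ≤ C |s|^μ` there with `μ < -1`, then for every `σ > 0` the
Bromwich integral `k(t) = (1/2π) ∫_ℝ e^{(σ+iy)t} K(σ+iy) dy` converges
absolutely and `k(t) = 0` for all `t ≤ r`. -/
theorem bromwich_causality
    (r : ℝ) (hr : 0 ≤ r) (μ : ℝ) (hμ : μ < -1) (K : ℂ → ℂ)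
    (hK : DifferentiableOn ℂ K {s : ℂ | 0 < s.re})
    (C : ℝ) (hC : 0 < C)
    (hbound : ∀ s : ℂ, 0 < s.re → ‖K s * Complex.exp (s * r)‖ ≤ C * ‖s‖ ^ μ) :
    ∀ σ : ℝ, 0 < σ →
      (∀ t : ℝ, Integrable (fun y : ℝ =>
          Complex.exp ((σ + y * Complex.I) * t) * K (σ + y * Complex.I))) ∧
      (∀ t : ℝ, t ≤ r →
        (1 / (2 * Real.pi) : ℝ) • ∫ y : ℝ,
            Complex.exp ((σ + y * Complex.I) * t) * K (σ + y * Complex.I) = 0) := by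
  intro σ hσ
  have hint := bromwich_integrable r μ hμ K hK C hC hbound σ hσ
  refine ⟨hint, fun t ht => ?_⟩
  have h1 := intervalIntegral_tendsto_integral (hint t)
    Filter.tendsto_neg_atTop_atBot Filter.tendsto_id
  have h2 : Filter.Tendsto (fun R : ℝ => 4 * C * R ^ (μ + 1)) Filter.atTop (nhds 0) := by
    have := (tendsto_rpow_neg_atTop (by linarith : 0 < -(μ + 1))).const_mul (4 * C)
    simpa only [neg_neg, mul_zero] using this
  have h3 := squeeze_zero_norm' (Filter.eventually_atTop.2 ⟨1, fun R hR =>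
    bromwich_box r μ hμ K hK C hC hbound σ hσ t ht R (by linarith)⟩) h2
  have h4 := tendsto_nhds_unique h1 h3
  rw [h4, smul_zero]
end

section
/- Let δ_BDF2(ζ) = (1-ζ) + (1/2)(1-ζ)². There exists a constant C > 0 such that for all Δt > 0, all r ≥ 0, and all s ∈ ℂ with Re s ≥ 0 and |s| Δt ≤ 1, setting s^{Δt} := δ_BDF2(e^{-s Δt})/Δt, one has |e^{-s r} - e^{-s^{Δt} r}| ≤ C r |s|³ Δt². -/
/-- The generating function of the BDF2 linear multistep method. -/
noncomputable def deltaBDF2 (ζ : ℂ) : ℂ := (1 - ζ) + (1 / 2) * (1 - ζ) ^ 2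

theorem aux_lip (a b : ℂ) (ha : a.re ≤ 0) (hb : b.re ≤ 0) :
    ‖Complex.exp a - Complex.exp b‖ ≤ ‖a - b‖ := by
  have := Convex.norm_image_sub_le_of_norm_deriv_le (𝕜 := ℂ) (f := Complex.exp) (C := 1)
    (s := {z : ℂ | z.re ≤ 0}) (x := b) (y := a)
    (fun x _ => Complex.differentiableAt_exp)
    (fun x hx => by
      rw [Complex.deriv_exp, Complex.norm_exp]
      exact Real.exp_le_one_iff.2 hx)
    (convex_halfSpace_re_le 0) hb ha
  simpa using this

theorem aux_re (ζ : ℂ) (h : ‖ζ‖ ≤ 1) : 0 ≤ (deltaBDF2 ζ).re := by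
  have h2 : ζ.re ^ 2 + ζ.im ^ 2 ≤ 1 := by
    have := Complex.sq_norm ζ
    rw [Complex.normSq_apply] at this
    nlinarith [norm_nonneg ζ]
  have : (deltaBDF2 ζ).re = 1 - ζ.re + 1 / 2 * ((1 - ζ.re) ^ 2 - ζ.im ^ 2) := by
    have e : deltaBDF2 ζ = (1 - ζ) + ((1 / 2 : ℝ) : ℂ) * ((1 - ζ) * (1 - ζ)) := by
      unfold deltaBDF2; push_cast; ring
    rw [e, Complex.add_re, Complex.re_ofReal_mul]
    simp only [Complex.mul_re, Complex.sub_re, Complex.sub_im, Complex.one_re, Complex.one_im]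
    ring
  rw [this]
  nlinarith [sq_nonneg (ζ.re - 1)]

theorem aux_cons (z : ℂ) (h : ‖z‖ ≤ 1) : ‖deltaBDF2 (Complex.exp (-z)) - z‖ ≤ 2 * ‖z‖ ^ 3 := by
  have hR := Complex.exp_bound (x := -z) (by simpa using h) (n := 3) (by norm_num)
  obtain ⟨R, hRd⟩ : ∃ R, R = Complex.exp (-z) - ∑ m ∈ Finset.range 3, (-z) ^ m / m.factorial :=
    ⟨_, rfl⟩
  rw [← hRd, norm_neg] at hR
  have he : Complex.exp (-z) = 1 - z + z ^ 2 / 2 + R := by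
    rw [hRd]; simp [Finset.sum_range_succ, Nat.factorial]; ring
  have hR' : ‖R‖ ≤ 2 / 9 * ‖z‖ ^ 3 := by
    refine hR.trans (le_of_eq ?_)
    norm_num [Nat.factorial]; ring
  have hR1 : ‖R‖ ≤ 2 / 9 := by
    have : ‖z‖ ^ 3 ≤ 1 := pow_le_one₀ (norm_nonneg _) h
    linarith
  have e : deltaBDF2 (Complex.exp (-z)) - z
      = z ^ 3 * (-1 / 2 + z / 8) + R * (-1 - z + z ^ 2 / 2 + R / 2) := by
    rw [he]; unfold deltaBDF2; ring
  have h1 : ‖(-1 / 2 + z / 8 : ℂ)‖ ≤ 5 / 8 := by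
    refine (norm_add_le _ _).trans ?_
    norm_num; linarith
  have h2 : ‖(-1 - z + z ^ 2 / 2 + R / 2 : ℂ)‖ ≤ 3 := by
    refine (norm_add_le _ _).trans ?_
    have := norm_add_le (-1 - z) (z ^ 2 / 2)
    have h3 := norm_sub_le (-1) z
    have h4 : ‖z‖ ^ 2 ≤ 1 := pow_le_one₀ (norm_nonneg _) h
    norm_num at this h3 ⊢
    linarith
  rw [e]
  refine (norm_add_le _ _).trans ?_
  rw [norm_mul, norm_mul, norm_pow]
  have h3 := mul_le_mul_of_nonneg_left h1 (pow_nonneg (norm_nonneg z) 3)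
  have h4 := mul_le_mul_of_nonneg_left h2 (norm_nonneg R)
  have := pow_nonneg (norm_nonneg z) 3
  linarith

/-- Error of the standard CQ approximation of the 3D wave
kernel factor: with `s^{Δt} = δ_BDF2(e^{-sΔt})/Δt`,
`|e^{-sr} - e^{-s^{Δt} r}| ≤ C r |s|³ Δt²` for `Re s ≥ 0`, `|s|Δt ≤ 1`. -/
theorem cq_kernel_error :
    ∃ C > (0 : ℝ), ∀ Δt : ℝ, 0 < Δt → ∀ r : ℝ, 0 ≤ r → ∀ s : ℂ,
      0 ≤ s.re → ‖s‖ * Δt ≤ 1 →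
      ‖Complex.exp (-s * r) -
          Complex.exp (-(deltaBDF2 (Complex.exp (-s * Δt)) / Δt) * r)‖
        ≤ C * r * ‖s‖ ^ 3 * Δt ^ 2 := by
  refine ⟨2, by norm_num, fun t ht r hr s hs hst => ?_⟩
  have hn : ‖s * (t : ℂ)‖ = ‖s‖ * t := by
    rw [norm_mul, Complex.norm_real, Real.norm_of_nonneg ht.le]
  have hc := aux_cons (s * t) (by rw [hn]; exact hst)
  rw [hn, ← neg_mul] at hc
  have hre := aux_re (Complex.exp (-s * t)) (by
    rw [Complex.norm_exp]
    apply Real.exp_le_one_iff.2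
    rw [Complex.re_mul_ofReal, Complex.neg_re]
    nlinarith)
  generalize deltaBDF2 (Complex.exp (-s * t)) = d at hc hre ⊢
  have ht' : (t : ℂ) ≠ 0 := by exact_mod_cast ht.ne'
  refine (aux_lip _ _ ?_ ?_).trans ?_
  · rw [Complex.re_mul_ofReal, Complex.neg_re]; nlinarith
  · rw [Complex.re_mul_ofReal, Complex.neg_re, Complex.div_ofReal_re]
    have := mul_nonneg (div_nonneg hre ht.le) hr
    linarith
  · have e : -s * (r : ℂ) - -(d / t) * r = (d - s * t) * ((r / t : ℝ) : ℂ) := by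
      push_cast; field_simp; ring
    rw [e, norm_mul, Complex.norm_real, Real.norm_of_nonneg (by positivity)]
    refine (mul_le_mul_of_nonneg_right hc (by positivity)).trans (le_of_eq ?_)
    field_simp
end

section
/- Let M, K, N be positive integers, let λ > 0, let ζ_{N+1} = e^{2πi/(N+1)}, and let A_0, …, A_N ∈ ℂ^{M×K} be given matrices. Define ω̃_n := (λ^{-n}/(N+1)) Σ_{k=0}^N A_k ζ_{N+1}^{k n} for n ∈ ℤ. Then for any vectors g_0, …, g_N ∈ ℂ^M and φ_0, …, φ_N ∈ ℂ^K, the all-steps convolution equations Σ_{ℓ=0}^N ω̃_{n-ℓ} φ_ℓ = g_n for all n = 0, …, N hold if and only if the N+1 decoupled equations A_k ( Σ_{ℓ=0}^N λ^ℓ φ_ℓ ζ_{N+1}^{-ℓ k} ) = Σ_{n=0}^N λ^n g_n ζ_{N+1}^{-k n} hold for all k = 0, …, N. -/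
open Finset

/-- The approximate convolution weights
`ω̃_n = (λ^{-n}/(N+1)) Σ_{k=0}^N A_k ζ_{N+1}^{kn}` obtained from the
trapezoidal rule applied to the Cauchy integral. -/
noncomputable def dftWeight (m k N : ℕ) (lam : ℝ)
    (A : ℕ → Matrix (Fin m) (Fin k) ℂ) (n : ℤ) : Matrix (Fin m) (Fin k) ℂ :=
  ((lam : ℂ) ^ (-n) / (N + 1)) •
    ∑ i ∈ Finset.range (N + 1),
      Complex.exp (2 * Real.pi * Complex.I / (N + 1)) ^ ((i : ℤ) * n) • A i

theorem aux_orth (N : ℕ) (z : ℂ) (hz : IsPrimitiveRoot z (N + 1)) (a b : ℕ)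
    (ha : a ≤ N) (hb : b ≤ N) :
    ∑ j ∈ Finset.range (N + 1), z ^ ((j : ℤ) * ((a : ℤ) - b)) =
      if a = b then ((N : ℂ) + 1) else 0 := by
  have h1 : ∀ j ∈ Finset.range (N + 1), z ^ ((j : ℤ) * ((a : ℤ) - b)) =
      (z ^ ((a : ℤ) - b)) ^ j := by
    intro j _
    rw [mul_comm, zpow_mul, zpow_natCast]
  rw [Finset.sum_congr rfl h1]
  split_ifs with h
  · subst h
    simp
  · have hne : z ^ ((a : ℤ) - b) ≠ 1 := by
      intro h2
      rw [hz.zpow_eq_one_iff_dvd] at h2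
      have h3 := Int.eq_zero_of_abs_lt_dvd h2 (by rw [abs_lt]; push_cast; constructor <;> omega)
      omega
    rw [geom_sum_eq hne, ← zpow_natCast, ← zpow_mul, mul_comm, zpow_mul, zpow_natCast,
      hz.pow_eq_one]
    simp

theorem aux_inv (m N : ℕ) (l z : ℂ) (hl : l ≠ 0) (hz : IsPrimitiveRoot z (N + 1))
    (U g : ℕ → Fin m → ℂ) :
    (∀ n ≤ N, ∑ i ∈ Finset.range (N + 1),
      (l ^ (-(n : ℤ)) / (N + 1) * z ^ ((i : ℤ) * n)) • U i = g n) ↔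
    (∀ i ≤ N, U i = ∑ n ∈ Finset.range (N + 1), (l ^ n * z ^ (-((i : ℤ) * n))) • g n) := by
  have hz0 : z ≠ 0 := hz.ne_zero (by omega)
  have hN : (N : ℂ) + 1 ≠ 0 := by exact_mod_cast Nat.succ_ne_zero N
  constructor
  · intro h i hi
    have h1 : ∀ n ∈ Finset.range (N + 1), (l ^ n * z ^ (-((i : ℤ) * n))) • g n =
        ∑ j ∈ Finset.range (N + 1), (z ^ ((n : ℤ) * ((j : ℤ) - i)) / (N + 1)) • U j := by
      intro n hn
      rw [← h n (by simpa [Nat.lt_succ_iff] using hn), Finset.smul_sum]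
      refine Finset.sum_congr rfl fun j _ => ?_
      rw [smul_smul]
      congr 1
      have e : (n : ℤ) * ((j : ℤ) - i) = -((i : ℤ) * n) + (j : ℤ) * n := by ring
      rw [e, zpow_add₀ hz0, zpow_neg l, zpow_natCast]
      field_simp
    rw [Finset.sum_congr rfl h1, Finset.sum_comm]
    simp_rw [← Finset.sum_smul, ← Finset.sum_div]
    rw [Finset.sum_eq_single i]
    · rw [aux_orth N z hz i i hi hi, if_pos rfl, div_self hN, one_smul]
    · intro j hj hji
      rw [aux_orth N z hz j i (by simpa [Nat.lt_succ_iff] using hj) hi, if_neg hji]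
      simp
    · intro h'
      exact absurd (Finset.mem_range.2 (by omega)) h'
  · intro h n hn
    have h1 : ∀ i ∈ Finset.range (N + 1),
        (l ^ (-(n : ℤ)) / (N + 1) * z ^ ((i : ℤ) * n)) • U i =
        ∑ j ∈ Finset.range (N + 1),
          (z ^ ((i : ℤ) * ((n : ℤ) - j)) * (l ^ (-(n : ℤ)) * l ^ j / (N + 1))) • g j := by
      intro i hi
      rw [h i (by simpa [Nat.lt_succ_iff] using hi), Finset.smul_sum]
      refine Finset.sum_congr rfl fun j _ => ?_
      rw [smul_smul]
      congr 1
      have e : (i : ℤ) * ((n : ℤ) - j) = (i : ℤ) * n + -((i : ℤ) * j) := by ring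
      rw [e, zpow_add₀ hz0]
      ring
    rw [Finset.sum_congr rfl h1, Finset.sum_comm]
    simp_rw [← Finset.sum_smul, ← Finset.sum_mul]
    rw [Finset.sum_eq_single n]
    · rw [aux_orth N z hz n n hn hn, if_pos rfl, zpow_neg, zpow_natCast,
        inv_mul_cancel₀ (pow_ne_zero _ hl), mul_one_div_cancel hN, one_smul]
    · intro j hj hji
      rw [aux_orth N z hz n j hn (by simpa [Nat.lt_succ_iff] using hj), if_neg (Ne.symm hji)]
      simp
    · intro h'
      exact absurd (Finset.mem_range.2 (by omega)) h'

/-- The all-steps-at-once convolution system with the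
DFT-based weights is equivalent to `N+1` decoupled linear systems, one per
frequency, via scaled discrete Fourier transforms. -/
theorem allsteps_decoupling (m k N : ℕ) (hm : 0 < m) (hk : 0 < k) (hN : 0 < N)
    (lam : ℝ) (hlam : 0 < lam)
    (A : ℕ → Matrix (Fin m) (Fin k) ℂ)
    (g : ℕ → Fin m → ℂ) (φ : ℕ → Fin k → ℂ) :
    (∀ n ≤ N, ∑ ℓ ∈ Finset.range (N + 1),
        (dftWeight m k N lam A ((n : ℤ) - ℓ)).mulVec (φ ℓ) = g n) ↔
    (∀ i ≤ N, (A i).mulVec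
        (∑ ℓ ∈ Finset.range (N + 1),
          ((lam : ℂ) ^ ℓ *
            Complex.exp (2 * Real.pi * Complex.I / (N + 1)) ^ (-((ℓ : ℤ) * i))) • φ ℓ)
      = ∑ n ∈ Finset.range (N + 1),
          ((lam : ℂ) ^ n *
            Complex.exp (2 * Real.pi * Complex.I / (N + 1)) ^ (-((i : ℤ) * n))) • g n) := by
  have hl : (lam : ℂ) ≠ 0 := by exact_mod_cast hlam.ne'
  have hz : IsPrimitiveRoot (Complex.exp (2 * Real.pi * Complex.I / (N + 1))) (N + 1) := by
    have := Complex.isPrimitiveRoot_exp (N + 1) (Nat.succ_ne_zero N)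
    push_cast at this
    exact this
  unfold dftWeight
  generalize Complex.exp (2 * Real.pi * Complex.I / (N + 1)) = z at hz ⊢
  have hz0 : z ≠ 0 := hz.ne_zero (by omega)
  rw [← aux_inv m N (lam : ℂ) z hl hz (fun i => (A i).mulVec
        (∑ ℓ ∈ Finset.range (N + 1), ((lam : ℂ) ^ ℓ * z ^ (-((ℓ : ℤ) * i))) • φ ℓ)) g]
  refine forall_congr' fun n => forall_congr' fun _ => ?_
  refine Eq.congr_left ?_
  simp_rw [Matrix.mulVec_sum, Matrix.smul_mulVec, Matrix.sum_mulVec, Matrix.mulVec_smul,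
    Matrix.smul_mulVec, Finset.smul_sum, smul_smul]
  rw [Finset.sum_comm]
  refine Finset.sum_congr rfl fun i _ => Finset.sum_congr rfl fun j _ => ?_
  congr 1
  have e : (i : ℤ) * ((n : ℤ) - j) = (i : ℤ) * n + -((j : ℤ) * i) := by ring
  have e' : -((n : ℤ) - j) = -(n : ℤ) + j := by ring
  rw [e, e', zpow_add₀ hz0, zpow_add₀ hl, zpow_natCast]
  ring
end

section
/- Let δ_BDF2(ζ) = (1-ζ) + (1/2)(1-ζ)². For every Δt > 0 and every s ∈ ℂ with Re s > 0, the mapped frequency s^{Δt} := δ_BDF2(e^{-s Δt})/Δt satisfies Re s^{Δt} > 0. -/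
/-- For every time step `Δt > 0` and `Re s > 0` the BDF2
mapped frequency `s^{Δt} = δ_BDF2(e^{-sΔt})/Δt` lies in the right half-plane. -/
theorem deltaBDF2_mapped_frequency (Δt : ℝ) (hΔt : 0 < Δt) (s : ℂ) (hs : 0 < s.re) :
    0 < (deltaBDF2 (Complex.exp (-s * Δt)) / Δt).re := by
  have hz : Complex.normSq (Complex.exp (-s * Δt)) < 1 := by
    rw [Complex.normSq_eq_norm_sq, Complex.norm_exp]
    have h1 : (-s * (Δt : ℂ)).re < 0 := by
      simp
      positivity
    have h2 := Real.exp_lt_one_iff.mpr h1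
    have h3 := Real.exp_pos (-s * (Δt : ℂ)).re
    nlinarith
  generalize Complex.exp (-s * Δt) = z at hz
  rw [Complex.div_ofReal_re]
  apply div_pos _ hΔt
  rw [Complex.normSq_apply] at hz
  have h : (deltaBDF2 z).re = (1 - z.re) + ((1 - z.re) ^ 2 - z.im ^ 2) / 2 := by
    simp [deltaBDF2, pow_two]
    ring
  rw [h]
  nlinarith [sq_nonneg (1 - z.re)]
end
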